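/- arXiv:2410.09801 — 8 statements merged into one kernel-verified Lean document; each statement's English description precedes it below -/
import Mathlib

section
/- Suppose μ_1 is a probability measure on X, u_k : X → U (k = 1,…,T−1) are measurable feedback maps, and μ_{k+1} := (x ↦ f_k(x, u_k(x)))_# μ_k for k = 1,…,T−1. Let v_1,…,v_T : X → ℝ be measurable functions such that each v_k is integrable with respect to μ_k, each x ↦ L_k(x, u_k(x)) is integrable with respect to μ_k, and the Bellman inequality v_k(x) ≤ L_k(x,u) + v_{k+1}(f_k(x,u)) holds for all x ∈ X, u ∈ U and all k = 1,…,T−1. Then ∑_{k=1}^{T−1} ∫_X L_k(x, u_k(x)) dμ_k(x) ≥ ∫_X v_1 dμ_1 − ∫_X v_T dμ_T. -/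
open MeasureTheory Finset
open scoped ENNReal

noncomputable section

/-- if `μ_{k+1}` is the pushforward of `μ_k` by the closed-loop map
`x ↦ f_k(x, u_k(x))` and `v_1, …, v_T` is a sub-solution of the boundary-free Bellman
equation (with the stated integrability), then
`∑_{k=1}^{T-1} ∫ L_k(x, u_k(x)) dμ_k ≥ ∫ v_1 dμ_1 - ∫ v_T dμ_T`.
(Indices are `0`-based: the time stamps are `0, 1, …, T-1`.) -/
theorem bellman_subsolution_lower_bound
    {X U : Type*} [TopologicalSpace X] [PolishSpace X] [MeasurableSpace X] [BorelSpace X]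
    [TopologicalSpace U] [CompactSpace U] [Nonempty U] [MeasurableSpace U] [BorelSpace U]
    (T : ℕ) (hT : 1 < T)
    (f : ℕ → X → U → X) (hf : ∀ k, Continuous fun p : X × U => f k p.1 p.2)
    (L : ℕ → X → U → ℝ) (hL : ∀ k, Continuous fun p : X × U => L k p.1 p.2)
    (hL0 : ∀ k x u, 0 ≤ L k x u)
    (u : ℕ → X → U) (hu : ∀ k, Measurable (u k))
    (hfu : ∀ k, Measurable fun x => f k x (u k x))
    (μ : ℕ → Measure X) [IsProbabilityMeasure (μ 0)]
    (hμ : ∀ k, k < T - 1 → μ (k + 1) = (μ k).map fun x => f k x (u k x))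
    (v : ℕ → X → ℝ) (hv : ∀ k, Measurable (v k))
    (hvint : ∀ k, k ≤ T - 1 → Integrable (v k) (μ k))
    (hLint : ∀ k, k < T - 1 → Integrable (fun x => L k x (u k x)) (μ k))
    (hBell : ∀ k, k < T - 1 → ∀ (x : X) (a : U), v k x ≤ L k x a + v (k + 1) (f k x a)) :
    (∫ x, v 0 x ∂(μ 0)) - ∫ x, v (T - 1) x ∂(μ (T - 1)) ≤
      ∑ k ∈ Finset.range (T - 1), ∫ x, L k x (u k x) ∂(μ k) := by
  have hstep : ∀ k ∈ Finset.range (T - 1),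
      (∫ x, v k x ∂(μ k)) - ∫ x, v (k + 1) x ∂(μ (k + 1)) ≤ ∫ x, L k x (u k x) ∂(μ k) := by
    intro k hk
    have hk' : k < T - 1 := Finset.mem_range.mp hk
    have hnext : Integrable (v (k + 1)) ((μ k).map fun x => f k x (u k x)) :=
      hμ k hk' ▸ hvint (k + 1) hk'
    have hcomp : Integrable (fun x => v (k + 1) (f k x (u k x))) (μ k) :=
      hnext.comp_measurable (hfu k)
    rw [hμ k hk', integral_map (hfu k).aemeasurable (hv (k + 1)).aestronglyMeasurable,
      sub_le_iff_le_add, ← integral_add (hLint k hk') hcomp]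
    exact integral_mono (hvint k hk'.le) ((hLint k hk').add hcomp)
      fun x => hBell k hk' x (u k x)
  rw [← Finset.sum_range_sub' (fun k => ∫ x, v k x ∂(μ k)) (T - 1)]
  exact Finset.sum_le_sum hstep
end
end

section
/- Equality of the lifted dynamic and Kantorovich values (𝒟_1 = 𝒦): assume c_1^T is Borel measurable and there exists a measurable map Ψ : X × X → 𝒳_U with e_1(Ψ(x,y)) = x, e_T(Ψ(x,y)) = y and 𝒜(Ψ(x,y)) = c_1^T(x,y) for all (x,y). Then for any two probability measures μ_1, μ_T on X, inf { ∫_{𝒳_U} 𝒜 dη : η a probability measure on 𝒳_U with (e_1)_# η = μ_1 and (e_T)_# η = μ_T } = inf { ∫_{X×X} c_1^T dπ : π ∈ Γ(μ_1, μ_T) }, both infima taken in [0,∞]. -/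
open MeasureTheory Finset
open scoped ENNReal

noncomputable section

/-- Trajectory of the discrete-time system `x_{k+1} = f_k(x_k, u_k)` started at time `i`
in state `x` under the control sequence `u`, after `m` steps. -/
def trajFrom {X U : Type*} (f : ℕ → X → U → X) (i : ℕ) (x : X) (u : ℕ → U) : ℕ → X
  | 0 => x
  | m + 1 => f (i + m) (trajFrom f i x u m) (u (i + m))

/-- The optimal steering cost `c_i^j(x, y)` in `[0,∞]`. -/
def steerCost {X U : Type*} (f : ℕ → X → U → X) (L : ℕ → X → U → ℝ) (i j : ℕ)
    (x y : X) : ℝ≥0∞ :=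
  ⨅ (u : ℕ → U) (_ : trajFrom f i x u (j - i) = y),
    ∑ k ∈ Finset.range (j - i), ENNReal.ofReal (L (i + k) (trajFrom f i x u k) (u (i + k)))

/-- The control sequence of a curve `γ = (x_1, u_1, …, u_{T-1}) ∈ 𝒳_U = X × U^{T-1}`,
extended to all of `ℕ` (with an arbitrary value beyond time `T-1`). -/
def curveCtrl {X U : Type*} [Nonempty U] (T : ℕ) (γ : X × (Fin (T - 1) → U)) : ℕ → U :=
  fun k => if h : k < T - 1 then γ.2 ⟨k, h⟩ else Classical.arbitrary U

/-- The terminal state `e_T(γ)` of a curve `γ ∈ 𝒳_U`. -/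
def curveEnd {X U : Type*} [Nonempty U] (f : ℕ → X → U → X) (T : ℕ)
    (γ : X × (Fin (T - 1) → U)) : X :=
  trajFrom f 0 γ.1 (curveCtrl T γ) (T - 1)

/-- The action `𝒜(γ) = ∑_{k=1}^{T-1} L_k(x_k, u_k)` of a curve `γ ∈ 𝒳_U`, in `[0,∞]`. -/
def curveAction {X U : Type*} [Nonempty U] (f : ℕ → X → U → X) (L : ℕ → X → U → ℝ)
    (T : ℕ) (γ : X × (Fin (T - 1) → U)) : ℝ≥0∞ :=
  ∑ k ∈ Finset.range (T - 1),
    ENNReal.ofReal (L k (trajFrom f 0 γ.1 (curveCtrl T γ) k) (curveCtrl T γ k))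


/-- The steering cost between the endpoints of a curve is at most its action. -/
theorem steerCost_le_curveAction {X U : Type*} [Nonempty U] (f : ℕ → X → U → X)
    (L : ℕ → X → U → ℝ) (T : ℕ) (γ : X × (Fin (T - 1) → U)) :
    steerCost f L 0 (T - 1) γ.1 (curveEnd f T γ) ≤ curveAction f L T γ := by
  simp only [steerCost, curveAction, zero_add, Nat.sub_zero]
  refine iInf_le_of_le (curveCtrl T γ) ?_
  exact iInf_le_of_le rfl le_rfl

/-- equality of the lifted dynamic value `𝒟_1` and the Kantorovich value `𝒦`:
the infimum of `∫ 𝒜 dη` over probability measures `η` on the curve space `𝒳_U` with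
`(e_1)_# η = μ_1`, `(e_T)_# η = μ_T` equals the infimum of `∫ c_1^T dπ` over couplings
`π ∈ Γ(μ_1, μ_T)` (both in `[0,∞]`), provided `c_1^T` is Borel measurable and a measurable
selection `Ψ` of minimizing curves exists. -/
theorem lifted_dynamic_eq_kantorovich
    {X U : Type*} [TopologicalSpace X] [PolishSpace X] [MeasurableSpace X] [BorelSpace X]
    [TopologicalSpace U] [CompactSpace U] [Nonempty U] [MeasurableSpace U] [BorelSpace U]
    (T : ℕ) (hT : 1 < T)
    (f : ℕ → X → U → X) (hf : ∀ k, Continuous fun p : X × U => f k p.1 p.2)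
    (L : ℕ → X → U → ℝ) (hL : ∀ k, Continuous fun p : X × U => L k p.1 p.2)
    (hL0 : ∀ k x u, 0 ≤ L k x u)
    (hc : Measurable fun p : X × X => steerCost f L 0 (T - 1) p.1 p.2)
    (heT : Measurable (curveEnd f T (X := X) (U := U)))
    (hA : Measurable (curveAction f L T (X := X) (U := U)))
    (Ψ : X × X → X × (Fin (T - 1) → U)) (hΨ : Measurable Ψ)
    (hΨ1 : ∀ x y : X, (Ψ (x, y)).1 = x)
    (hΨT : ∀ x y : X, curveEnd f T (Ψ (x, y)) = y)
    (hΨA : ∀ x y : X, curveAction f L T (Ψ (x, y)) = steerCost f L 0 (T - 1) x y)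
    (μ1 μT : Measure X) [IsProbabilityMeasure μ1] [IsProbabilityMeasure μT] :
    (⨅ (η : Measure (X × (Fin (T - 1) → U))) (_ : IsProbabilityMeasure η)
        (_ : η.map (fun γ => γ.1) = μ1) (_ : η.map (curveEnd f T) = μT),
          ∫⁻ γ, curveAction f L T γ ∂η) =
      ⨅ (π : Measure (X × X)) (_ : IsProbabilityMeasure π)
        (_ : π.map Prod.fst = μ1) (_ : π.map Prod.snd = μT),
          ∫⁻ p, steerCost f L 0 (T - 1) p.1 p.2 ∂π := by
  apply le_antisymm
  · refine le_iInf fun π => le_iInf fun hπ => le_iInf fun h1 => le_iInf fun h2 => ?_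
    refine (iInf₂_le (π.map Ψ) (Measure.isProbabilityMeasure_map hΨ.aemeasurable)).trans ?_
    refine (iInf₂_le ?_ ?_).trans_eq ?_
    · rw [Measure.map_map measurable_fst hΨ, ← h1]
      exact congrArg (Measure.map · π) (funext fun p => hΨ1 p.1 p.2)
    · rw [Measure.map_map heT hΨ, ← h2]
      exact congrArg (Measure.map · π) (funext fun p => hΨT p.1 p.2)
    · rw [lintegral_map hA hΨ]
      exact lintegral_congr fun p => hΨA p.1 p.2
  · refine le_iInf fun η => le_iInf fun hη => le_iInf fun h1 => le_iInf fun h2 => ?_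
    have he : Measurable fun γ : X × (Fin (T - 1) → U) => (γ.1, curveEnd f T γ) :=
      measurable_fst.prodMk heT
    refine (iInf₂_le (η.map fun γ => (γ.1, curveEnd f T γ))
      (Measure.isProbabilityMeasure_map he.aemeasurable)).trans ?_
    refine (iInf₂_le ?_ ?_).trans ?_
    · rw [Measure.map_map measurable_fst he, ← h1]
      rfl
    · rw [Measure.map_map measurable_snd he, ← h2]
      rfl
    · rw [lintegral_map hc he]
      exact lintegral_mono fun γ => steerCost_le_curveAction f L T γ
end
end

section
/- Characterization of minimizers of the lifted problem: assume c_1^T is Borel measurable, there exists a measurable map Ψ : X × X → 𝒳_U with e_1(Ψ(x,y)) = x, e_T(Ψ(x,y)) = y and 𝒜(Ψ(x,y)) = c_1^T(x,y) for all (x,y), and the Kantorovich value 𝒦 := inf { ∫ c_1^T dπ : π ∈ Γ(μ_1, μ_T) } is finite. Let η be a probability measure on 𝒳_U with (e_1)_# η = μ_1 and (e_T)_# η = μ_T. Then η attains the infimum of ∫ 𝒜 dη' over all such measures η' if and only if 𝒜(γ) = c_1^T(e_1γ, e_Tγ) for η-almost every γ and (e_1, e_T)_# η attains the Kantorovich infimum.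 In particular, if η is a minimizer then π := (e_1, e_T)_# η is a minimizer of the Kantorovich problem. -/
open MeasureTheory Finset
open scoped ENNReal

noncomputable section

/-- Lifting along a measurable optimal section `Ψ` of `e` preserves the infimum of the cost. -/
theorem iInf_lintegral_lift_eq {Γ Z : Type*} [MeasurableSpace Γ] [MeasurableSpace Z]
    {e : Γ → Z} (he : Measurable e) {A : Γ → ℝ≥0∞} (hA : Measurable A)
    {c : Z → ℝ≥0∞} (hc : Measurable c) (hcA : ∀ γ, c (e γ) ≤ A γ)
    {Ψ : Z → Γ} (hΨ : Measurable Ψ) (heΨ : ∀ z, e (Ψ z) = z) (hAΨ : ∀ z, A (Ψ z) = c z)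
    (P : Set (Measure Z)) :
    (⨅ (η : Measure Γ) (_ : η.map e ∈ P), ∫⁻ γ, A γ ∂η) = ⨅ π ∈ P, ∫⁻ z, c z ∂π := by
  refine le_antisymm (le_iInf₂ fun π hπ => ?_) (le_iInf₂ fun η hη => ?_)
  · have hmap : (π.map Ψ).map e = π := by
      rw [Measure.map_map he hΨ, show e ∘ Ψ = id from funext heΨ, Measure.map_id]
    refine (iInf₂_le (π.map Ψ) (hmap.symm ▸ hπ)).trans (le_of_eq ?_)
    rw [lintegral_map hA hΨ]
    simp_rw [hAΨ]
  · refine (iInf₂_le (η.map e) hη).trans ?_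
    rw [lintegral_map hc he]
    exact lintegral_mono hcA

/-- If `c ∘ e ≤ A` and `K` is a finite lower bound of the cost of `η.map e`, then `∫ A` equals `K`
iff `A = c ∘ e` almost everywhere and the cost of `η.map e` equals `K`. -/
theorem lintegral_eq_iff_ae_eq_and_lintegral_map_eq {Γ Z : Type*} [MeasurableSpace Γ]
    [MeasurableSpace Z] {e : Γ → Z} (he : Measurable e) {A : Γ → ℝ≥0∞} (hA : Measurable A)
    {c : Z → ℝ≥0∞} (hc : Measurable c) (hcA : ∀ γ, c (e γ) ≤ A γ) {η : Measure Γ}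
    {K : ℝ≥0∞} (hK : K ≠ ⊤) (hKη : K ≤ ∫⁻ z, c z ∂(η.map e)) :
    (∫⁻ γ, A γ ∂η) = K ↔
      (∀ᵐ γ ∂η, A γ = c (e γ)) ∧ (∫⁻ z, c z ∂(η.map e)) = K := by
  rw [lintegral_map hc he] at hKη ⊢
  constructor
  · intro h
    have hcK : (∫⁻ γ, c (e γ) ∂η) = K := le_antisymm (h ▸ lintegral_mono hcA) hKη
    refine ⟨?_, hcK⟩
    filter_upwards [ae_eq_of_ae_le_of_lintegral_le (Filter.Eventually.of_forall hcA)
      (hcK ▸ hK) hA.aemeasurable (h.trans hcK.symm).le] with γ hγ using hγ.symm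
  · rintro ⟨hae, hcK⟩
    rw [lintegral_congr_ae hae, hcK]

/-- characterization of minimizers of the lifted problem: a feasible `η`
attains the infimum of `∫ 𝒜 dη'` iff `𝒜(γ) = c_1^T(e_1 γ, e_T γ)` for `η`-a.e. `γ` and
`(e_1, e_T)_# η` attains the Kantorovich infimum.  In particular, if `η` is a minimizer
then `(e_1, e_T)_# η` is a minimizer of the Kantorovich problem. -/
theorem lifted_minimizer_characterization
    {X U : Type*} [TopologicalSpace X] [PolishSpace X] [MeasurableSpace X] [BorelSpace X]
    [TopologicalSpace U] [CompactSpace U] [Nonempty U] [MeasurableSpace U] [BorelSpace U]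
    (T : ℕ) (hT : 1 < T)
    (f : ℕ → X → U → X) (hf : ∀ k, Continuous fun p : X × U => f k p.1 p.2)
    (L : ℕ → X → U → ℝ) (hL : ∀ k, Continuous fun p : X × U => L k p.1 p.2)
    (hL0 : ∀ k x u, 0 ≤ L k x u)
    (hc : Measurable fun p : X × X => steerCost f L 0 (T - 1) p.1 p.2)
    (heT : Measurable (curveEnd f T (X := X) (U := U)))
    (hA : Measurable (curveAction f L T (X := X) (U := U)))
    (Ψ : X × X → X × (Fin (T - 1) → U)) (hΨ : Measurable Ψ)
    (hΨ1 : ∀ x y : X, (Ψ (x, y)).1 = x)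
    (hΨT : ∀ x y : X, curveEnd f T (Ψ (x, y)) = y)
    (hΨA : ∀ x y : X, curveAction f L T (Ψ (x, y)) = steerCost f L 0 (T - 1) x y)
    (μ1 μT : Measure X) [IsProbabilityMeasure μ1] [IsProbabilityMeasure μT]
    (hK : (⨅ (π : Measure (X × X)) (_ : IsProbabilityMeasure π)
        (_ : π.map Prod.fst = μ1) (_ : π.map Prod.snd = μT),
          ∫⁻ p, steerCost f L 0 (T - 1) p.1 p.2 ∂π) ≠ ⊤)
    (η : Measure (X × (Fin (T - 1) → U))) [IsProbabilityMeasure η]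
    (hη1 : η.map (fun γ => γ.1) = μ1) (hηT : η.map (curveEnd f T) = μT) :
    ((∫⁻ γ, curveAction f L T γ ∂η) =
        (⨅ (η' : Measure (X × (Fin (T - 1) → U))) (_ : IsProbabilityMeasure η')
          (_ : η'.map (fun γ => γ.1) = μ1) (_ : η'.map (curveEnd f T) = μT),
            ∫⁻ γ, curveAction f L T γ ∂η') ↔
      ((∀ᵐ γ ∂η, curveAction f L T γ = steerCost f L 0 (T - 1) γ.1 (curveEnd f T γ)) ∧
        (∫⁻ p, steerCost f L 0 (T - 1) p.1 p.2
            ∂(η.map fun γ => (γ.1, curveEnd f T γ))) =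
          ⨅ (π : Measure (X × X)) (_ : IsProbabilityMeasure π)
            (_ : π.map Prod.fst = μ1) (_ : π.map Prod.snd = μT),
              ∫⁻ p, steerCost f L 0 (T - 1) p.1 p.2 ∂π)) ∧
    ((∫⁻ γ, curveAction f L T γ ∂η) =
        (⨅ (η' : Measure (X × (Fin (T - 1) → U))) (_ : IsProbabilityMeasure η')
          (_ : η'.map (fun γ => γ.1) = μ1) (_ : η'.map (curveEnd f T) = μT),
            ∫⁻ γ, curveAction f L T γ ∂η') →
      (∫⁻ p, steerCost f L 0 (T - 1) p.1 p.2
          ∂(η.map fun γ => (γ.1, curveEnd f T γ))) =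
        ⨅ (π : Measure (X × X)) (_ : IsProbabilityMeasure π)
          (_ : π.map Prod.fst = μ1) (_ : π.map Prod.snd = μT),
            ∫⁻ p, steerCost f L 0 (T - 1) p.1 p.2 ∂π) := by
  have he : Measurable fun γ : X × (Fin (T - 1) → U) => (γ.1, curveEnd f T γ) :=
    measurable_fst.prodMk heT
  have hfst (η' : Measure (X × (Fin (T - 1) → U))) :
      (η'.map fun γ => (γ.1, curveEnd f T γ)).map Prod.fst = η'.map (fun γ => γ.1) :=
    Measure.map_map measurable_fst he
  have hsnd (η' : Measure (X × (Fin (T - 1) → U))) :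
      (η'.map fun γ => (γ.1, curveEnd f T γ)).map Prod.snd = η'.map (curveEnd f T) :=
    Measure.map_map measurable_snd he
  have hinf := iInf_lintegral_lift_eq he hA hc (steerCost_le_curveAction f L T) hΨ
    (fun p => Prod.ext (hΨ1 p.1 p.2) (hΨT p.1 p.2)) (fun p => hΨA p.1 p.2)
    {π | IsProbabilityMeasure π ∧ π.map Prod.fst = μ1 ∧ π.map Prod.snd = μT}
  simp only [Set.mem_ofPred_eq, iInf_and, hfst, hsnd,
    Measure.isProbabilityMeasure_map_iff he.aemeasurable] at hinf
  have key := lintegral_eq_iff_ae_eq_and_lintegral_map_eq he hA hc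
    (steerCost_le_curveAction f L T) (η := η) hK
    (iInf_le_of_le _ <| iInf_le_of_le (Measure.isProbabilityMeasure_map he.aemeasurable) <|
      iInf_le_of_le ((hfst η).trans hη1) <| iInf_le_of_le ((hsnd η).trans hηT) le_rfl)
  rw [hinf]
  exact ⟨key, fun h => (key.1 h).2⟩
end
end

section
/- Let φ, ψ : X → ℝ with ψ bounded and φ(x) − ψ(y) ≤ c_1^T(x,y) for all x, y ∈ X (feasibility for the Kantorovich–Rubinstein dual). Define v_2(x) := inf_{y ∈ X} ( c_2^T(x,y) + ψ(y) ), which is real-valued. Then for every x ∈ X, φ(x) ≤ inf_{u ∈ U} ( L_1(x,u) + v_2(f_1(x,u)) ); that is, φ is a sub-solution of the Bellman inequality at the first step. -/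
open MeasureTheory Finset
open scoped ENNReal

noncomputable section

theorem trajFrom_update_succ {X U : Type*} (f : ℕ → X → U → X) (i : ℕ) (x : X) (u : U)
    (w : ℕ → U) (m : ℕ) :
    trajFrom f i x (Function.update w i u) (m + 1) = trajFrom f (i + 1) (f i x u) w m := by
  induction m with
  | zero => simp [trajFrom]
  | succ m ih =>
    rw [trajFrom, ih, trajFrom, Function.update_of_ne (by omega)]
    simp only [add_assoc, add_comm 1 m]

/-- One half of the dynamic programming principle for the steering cost. -/
theorem steerCost_le_add_steerCost_succ {X U : Type*} (f : ℕ → X → U → X)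
    (L : ℕ → X → U → ℝ) {i j : ℕ} (hij : i < j) (x y : X) (u : U) :
    steerCost f L i j x y ≤
      ENNReal.ofReal (L i x u) + steerCost f L (i + 1) j (f i x u) y := by
  obtain ⟨n, rfl⟩ := Nat.exists_eq_add_of_lt hij
  have h₁ : i + n + 1 - i = n + 1 := by omega
  have h₂ : i + n + 1 - (i + 1) = n := by omega
  unfold steerCost
  rw [h₁, h₂]
  simp only [ENNReal.add_iInf]
  refine le_iInf₂ fun w hw => ?_
  refine (iInf₂_le (Function.update w i u) (by rw [trajFrom_update_succ, hw])).trans ?_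
  rw [Finset.sum_range_succ', add_comm]
  refine add_le_add (by simp [trajFrom]) (Finset.sum_le_sum fun k _ => ?_)
  rw [trajFrom_update_succ, Function.update_of_ne (by omega), add_assoc i 1 k, add_comm 1 k]

theorem exists_steerCost_ne_top {X U : Type*} [Nonempty U] (f : ℕ → X → U → X)
    (L : ℕ → X → U → ℝ) (i j : ℕ) (x : X) : ∃ y, steerCost f L i j x y ≠ ⊤ := by
  obtain ⟨u⟩ := ‹Nonempty U›
  refine ⟨trajFrom f i x (fun _ => u) (j - i), ne_top_of_le_ne_top ?_
    (iInf_le_of_le (fun _ => u) (iInf_le _ rfl))⟩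
  exact ENNReal.sum_ne_top.2 fun _ _ => ENNReal.ofReal_ne_top

/-- if `(φ, ψ)` is feasible for the Kantorovich–Rubinstein dual, i.e.
`φ(x) - ψ(y) ≤ c_1^T(x,y)` for all `x, y`, with `ψ` bounded, then
`v_2(x) := inf_y ( c_2^T(x,y) + ψ(y) )` is real-valued and
`φ(x) ≤ inf_{u ∈ U} ( L_1(x,u) + v_2(f_1(x,u)) )` for every `x`; that is, `φ` is a
sub-solution of the Bellman inequality at the first step.
(Indices are `0`-based: the time stamps are `0, 1, …, T-1`.) -/
theorem dual_feasible_is_bellman_subsolution_first_step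
    {X U : Type*} [TopologicalSpace X] [PolishSpace X]
    [TopologicalSpace U] [CompactSpace U] [Nonempty U]
    (T : ℕ) (hT : 1 < T)
    (f : ℕ → X → U → X) (hf : ∀ k, Continuous fun p : X × U => f k p.1 p.2)
    (L : ℕ → X → U → ℝ) (hL : ∀ k, Continuous fun p : X × U => L k p.1 p.2)
    (hL0 : ∀ k x u, 0 ≤ L k x u)
    (φ ψ : X → ℝ) (hψ : ∃ C : ℝ, ∀ y, |ψ y| ≤ C)
    (hfeas : ∀ x y : X,
      (φ x : EReal) - (ψ y : EReal) ≤ (steerCost f L 0 (T - 1) x y : EReal))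
    (v₂ : X → EReal)
    (hv₂ : ∀ x, v₂ x = ⨅ y : X, ((steerCost f L 1 (T - 1) x y : EReal) + (ψ y : EReal))) :
    (∀ x, ∃ r : ℝ, v₂ x = (r : EReal)) ∧
    (∀ x, (φ x : EReal) ≤
      ⨅ u : U, ((ENNReal.ofReal (L 0 x u) : EReal) + v₂ (f 0 x u))) := by
  obtain ⟨C, hC⟩ := hψ
  have hreal : ∀ x, ∃ r : ℝ, v₂ x = (r : EReal) := by
    intro x
    have hbot : ((-C : ℝ) : EReal) ≤ v₂ x := by
      rw [hv₂]
      refine le_iInf fun y => ?_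
      calc ((-C : ℝ) : EReal) ≤ (ψ y : EReal) := by exact_mod_cast (abs_le.1 (hC y)).1
        _ = 0 + (ψ y : EReal) := (zero_add _).symm
        _ ≤ _ := by gcongr; exact EReal.coe_ennreal_nonneg _
    have htop : v₂ x < ⊤ := by
      obtain ⟨y, hy⟩ := exists_steerCost_ne_top f L 1 (T - 1) x
      rw [hv₂]
      refine (iInf_le _ y).trans_lt (EReal.add_lt_top ?_ (EReal.coe_ne_top _))
      simpa using hy
    exact ⟨(v₂ x).toReal,
      (EReal.coe_toReal htop.ne ((EReal.bot_lt_coe _).trans_le hbot).ne').symm⟩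
  refine ⟨hreal, fun x => le_iInf fun u => ?_⟩
  obtain ⟨r, hr⟩ := hreal (f 0 x u)
  have key : ((φ x - L 0 x u : ℝ) : EReal) ≤ v₂ (f 0 x u) := by
    rw [hv₂]
    refine le_iInf fun y => ?_
    have hdpp := steerCost_le_add_steerCost_succ f L (show 0 < T - 1 by omega) x y u
    have hle := (hfeas x y).trans (EReal.coe_ennreal_le_coe_ennreal_iff.2 hdpp)
    rw [zero_add] at hle
    generalize steerCost f L 1 (T - 1) (f 0 x u) y = c at hle ⊢
    rcases eq_or_ne c ⊤ with rfl | hc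
    · simp
    · lift c to NNReal using hc
      rw [EReal.coe_ennreal_add, EReal.coe_ennreal_ofReal, max_eq_left (hL0 0 x u),
        EReal.coe_nnreal_eq_coe_real] at hle
      rw [EReal.coe_nnreal_eq_coe_real]
      have hle' : φ x - ψ y ≤ L 0 x u + c := by exact_mod_cast hle
      have : φ x - L 0 x u ≤ c + ψ y := by linarith
      exact_mod_cast this
  rw [hr] at key ⊢
  rw [EReal.coe_ennreal_ofReal, max_eq_left (hL0 0 x u)]
  have : φ x - L 0 x u ≤ r := by exact_mod_cast key
  have : φ x ≤ L 0 x u + r := by linarith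
  exact_mod_cast this
end
end

section
/- Let A ∈ ℝ^{n×n} be symmetric, c ∈ ℝ^n, and d ∈ ℝ. Then x^T A x + 2 c^T x + d ≥ 0 for all x ∈ ℝ^n if and only if the (n+1)×(n+1) block matrix fromBlocks A c; c^T d (i.e. [[A, c],[c^T, d]]) is positive semidefinite. -/
open Matrix

lemma dotProduct_fromBlocks_mulVec_sumElim {m : Type*} [Fintype m]
    (A : Matrix m m ℝ) (c : m → ℝ) (d : ℝ) (x : m → ℝ) (t : Fin 1 → ℝ) :
    Sum.elim x t ⬝ᵥ (Matrix.fromBlocks A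
        (Matrix.of fun i (_ : Fin 1) => c i)
        (Matrix.of fun (_ : Fin 1) j => c j)
        (Matrix.of fun (_ : Fin 1) (_ : Fin 1) => d)).mulVec (Sum.elim x t) =
      x ⬝ᵥ A.mulVec x + 2 * t 0 * (c ⬝ᵥ x) + t 0 ^ 2 * d := by
  have hcol : x ⬝ᵥ (Matrix.of fun i (_ : Fin 1) => c i).mulVec t = t 0 * (c ⬝ᵥ x) := by
    simp only [dotProduct, mulVec, Matrix.of_apply, Fin.sum_univ_one, Finset.mul_sum]
    exact Finset.sum_congr rfl fun i _ => by ring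
  have hrow : t ⬝ᵥ (Matrix.of fun (_ : Fin 1) j => c j).mulVec x = t 0 * (c ⬝ᵥ x) := by
    simp [dotProduct, mulVec]
  have hd : t ⬝ᵥ (Matrix.of fun (_ : Fin 1) (_ : Fin 1) => d).mulVec t = t 0 ^ 2 * d := by
    simp only [dotProduct, mulVec, Matrix.of_apply, Fin.sum_univ_one]
    ring
  rw [fromBlocks_mulVec, sumElim_dotProduct_sumElim]
  simp only [Sum.elim_comp_inl, Sum.elim_comp_inr, dotProduct_add, hcol, hrow, hd]
  ring

lemma leadingCoeff_nonneg_of_quadratic_nonneg {a b d : ℝ}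
    (h : ∀ s : ℝ, 0 ≤ s ^ 2 * a + 2 * s * b + d) : 0 ≤ a := by
  by_contra! ha
  have hd : 0 ≤ d := by simpa using h 0
  have hua : d / (-a) * a = -d := by
    rw [div_neg, neg_mul, div_mul_cancel₀ d ha.ne]
  have hu : 0 ≤ d / (-a) := div_nonneg hd (by linarith)
  have hpos := h (1 + d / (-a))
  have hneg := h (-(1 + d / (-a)))
  nlinarith [mul_nonneg hu hd]

/-- for a real symmetric matrix `A`, a vector `c` and a scalar `d`,
`xᵀ A x + 2 cᵀ x + d ≥ 0` for all `x` iff the block matrix `[[A, c], [cᵀ, d]]` is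
positive semidefinite. -/
theorem quadratic_nonneg_iff_block_posSemidef
    (n : ℕ) (A : Matrix (Fin n) (Fin n) ℝ) (hA : A.IsSymm)
    (c : Fin n → ℝ) (d : ℝ) :
    (∀ x : Fin n → ℝ, 0 ≤ x ⬝ᵥ A.mulVec x + 2 * (c ⬝ᵥ x) + d) ↔
      (Matrix.fromBlocks A
        (Matrix.of fun i (_ : Fin 1) => c i)
        (Matrix.of fun (_ : Fin 1) j => c j)
        (Matrix.of fun (_ : Fin 1) (_ : Fin 1) => d)).PosSemidef := by
  constructor
  · intro h
    have hs (x : Fin n → ℝ) (s : ℝ) :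
        0 ≤ s ^ 2 * (x ⬝ᵥ A.mulVec x) + 2 * s * (c ⬝ᵥ x) + d := by
      have := h (s • x)
      simp only [mulVec_smul, dotProduct_smul, smul_dotProduct, smul_eq_mul] at this
      linarith
    refine PosSemidef.of_dotProduct_mulVec_nonneg ?_ fun v => ?_
    · refine IsHermitian.fromBlocks ?_ ?_ ?_
      · rwa [IsHermitian, conjTranspose_eq_transpose_of_trivial]
      · ext i j
        simp
      · ext i j
        simp
    · obtain ⟨x, t, rfl⟩ : ∃ x t, v = Sum.elim x t :=
        ⟨v ∘ Sum.inl, v ∘ Sum.inr, (Sum.elim_comp_inl_inr v).symm⟩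
      rw [star_trivial, dotProduct_fromBlocks_mulVec_sumElim]
      by_cases ht : t 0 = 0
      · simpa [ht] using leadingCoeff_nonneg_of_quadratic_nonneg (hs x)
      · have := mul_nonneg (sq_nonneg (t 0)) (hs x (t 0)⁻¹)
        convert this using 1
        field_simp
  · intro h x
    have := h.dotProduct_mulVec_nonneg (Sum.elim x 1)
    rw [star_trivial, dotProduct_fromBlocks_mulVec_sumElim] at this
    simpa using this
end

section
/- Let A ∈ ℝ^{n×n} be invertible, B ∈ ℝ^{n×m}, Q ∈ ℝ^{n×n} symmetric positive semidefinite, R ∈ ℝ^{m×m} symmetric positive definite, and let P, M ∈ ℝ^{n×n} be symmetric. Then the quadratic Bellman inequality x^T M x ≤ x^T Q x + u^T R u + (Ax + Bu)^T P (Ax + Bu) holds for all x ∈ ℝ^n and u ∈ ℝ^m if and only if R + B^T P B is positive definite and the (m+n)×(m+n) block matrix fromBlocks (R + B^T P B) (B^T P A); (A^T P B) (A^T P A − M + Q) is positive semidefinite. -/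
open Matrix

lemma dotProduct_transpose_mul_mul_mulVec {ι κ α β : Type*} [Fintype ι] [Fintype κ] [Fintype α]
    [Fintype β] (C : Matrix ι α ℝ) (P : Matrix ι κ ℝ) (D : Matrix κ β ℝ) (v : α → ℝ) (w : β → ℝ) :
    v ⬝ᵥ (Cᵀ * P * D) *ᵥ w = (C *ᵥ v) ⬝ᵥ P *ᵥ (D *ᵥ w) := by
  rw [← mulVec_mulVec, ← mulVec_mulVec, dotProduct_mulVec, vecMul_transpose]

/-- The quadratic form of the block matrix is the slack in the quadratic Bellman inequality. -/
lemma bellman_block_quadratic_form {ι κ : Type*} [Fintype ι] [Fintype κ]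
    (A : Matrix ι ι ℝ) (B : Matrix ι κ ℝ) (Q : Matrix ι ι ℝ) (R : Matrix κ κ ℝ)
    (P M : Matrix ι ι ℝ) (x : ι → ℝ) (u : κ → ℝ) :
    Sum.elim u x ⬝ᵥ (fromBlocks (R + Bᵀ * P * B) (Bᵀ * P * A)
        (Aᵀ * P * B) (Aᵀ * P * A - M + Q)) *ᵥ Sum.elim u x =
      x ⬝ᵥ Q *ᵥ x + u ⬝ᵥ R *ᵥ u + (A *ᵥ x + B *ᵥ u) ⬝ᵥ P *ᵥ (A *ᵥ x + B *ᵥ u)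
        - x ⬝ᵥ M *ᵥ x := by
  simp only [fromBlocks_mulVec, Sum.elim_comp_inl, Sum.elim_comp_inr,
    sumElim_dotProduct_sumElim, add_mulVec, sub_mulVec, mulVec_add, dotProduct_add,
    dotProduct_sub, add_dotProduct,
    dotProduct_transpose_mul_mul_mulVec]
  ring

lemma bellman_block_isHermitian {ι κ : Type*} [Fintype ι]
    (A : Matrix ι ι ℝ) (B : Matrix ι κ ℝ) {Q : Matrix ι ι ℝ} {R : Matrix κ κ ℝ}
    {P M : Matrix ι ι ℝ} (hQ : Q.IsSymm) (hR : R.IsSymm) (hP : P.IsSymm) (hM : M.IsSymm) :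
    (fromBlocks (R + Bᵀ * P * B) (Bᵀ * P * A)
      (Aᵀ * P * B) (Aᵀ * P * A - M + Q)).IsHermitian := by
  rw [IsHermitian, conjTranspose_eq_transpose_of_trivial, fromBlocks_transpose]
  simp only [transpose_add, transpose_sub, transpose_mul, transpose_transpose,
    hQ.eq, hR.eq, hP.eq, hM.eq, Matrix.mul_assoc]

/-- If the block matrix is positive semidefinite, `A` is invertible and `R` is positive definite,
then the upper left block is positive definite. -/
lemma posDef_of_bellman_block_posSemidef {ι κ : Type*} [Fintype ι] [DecidableEq ι] [Fintype κ]
    {A : Matrix ι ι ℝ} (hA : IsUnit A.det) {B : Matrix ι κ ℝ} {R : Matrix κ κ ℝ}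
    (hR : R.PosDef) {P N : Matrix ι ι ℝ}
    (h : (fromBlocks (R + Bᵀ * P * B) (Bᵀ * P * A) (Aᵀ * P * B) N).PosSemidef) :
    (R + Bᵀ * P * B).PosDef := by
  have hS : (R + Bᵀ * P * B).PosSemidef := h.submatrix Sum.inl
  refine .of_dotProduct_mulVec_pos hS.isHermitian fun u hu ↦
    (hS.dotProduct_mulVec_nonneg u).lt_of_ne' fun h0 ↦ ?_
  have hker := (h.dotProduct_mulVec_zero_iff (Sum.elim u 0)).1 (by
    simpa [fromBlocks_mulVec, sumElim_dotProduct_sumElim] using h0)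
  have hx : (Aᵀ * P * B) *ᵥ u = 0 := by
    simpa [fromBlocks_mulVec] using congrArg (· ∘ Sum.inr) hker
  have hPB : P *ᵥ (B *ᵥ u) = 0 := by
    refine mulVec_injective_of_isUnit (A := Aᵀ)
      ((isUnit_iff_isUnit_det _).2 (by rwa [det_transpose])) ?_
    simpa [Matrix.mul_assoc, mulVec_mulVec] using hx
  have hpos := hR.dotProduct_mulVec_pos hu
  rw [add_mulVec, ← mulVec_mulVec, ← mulVec_mulVec, hPB, mulVec_zero, add_zero] at h0
  exact hpos.ne' h0

/-- for `A` invertible, `Q` symmetric PSD, `R` symmetric PD and `P, M`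
symmetric, the quadratic Bellman inequality
`xᵀ M x ≤ xᵀ Q x + uᵀ R u + (Ax + Bu)ᵀ P (Ax + Bu)` holds for all `x, u` iff
`R + Bᵀ P B` is positive definite and
`fromBlocks (R + Bᵀ P B) (Bᵀ P A) (Aᵀ P B) (Aᵀ P A - M + Q)` is positive semidefinite. -/
theorem quadratic_bellman_iff_sdp
    (n m : ℕ) (A : Matrix (Fin n) (Fin n) ℝ) (hA : IsUnit A.det)
    (B : Matrix (Fin n) (Fin m) ℝ)
    (Q : Matrix (Fin n) (Fin n) ℝ) (hQ : Q.PosSemidef)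
    (R : Matrix (Fin m) (Fin m) ℝ) (hR : R.PosDef)
    (P M : Matrix (Fin n) (Fin n) ℝ) (hP : P.IsSymm) (hM : M.IsSymm) :
    (∀ (x : Fin n → ℝ) (u : Fin m → ℝ),
        x ⬝ᵥ M.mulVec x ≤
          x ⬝ᵥ Q.mulVec x + u ⬝ᵥ R.mulVec u +
            (A.mulVec x + B.mulVec u) ⬝ᵥ P.mulVec (A.mulVec x + B.mulVec u)) ↔
      ((R + Bᵀ * P * B).PosDef ∧
        (Matrix.fromBlocks (R + Bᵀ * P * B) (Bᵀ * P * A)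
          (Aᵀ * P * B) (Aᵀ * P * A - M + Q)).PosSemidef) := by
  have hH := bellman_block_isHermitian A B
    ((conjTranspose_eq_transpose_of_trivial Q).symm.trans hQ.isHermitian)
    ((conjTranspose_eq_transpose_of_trivial R).symm.trans hR.isHermitian) hP hM
  constructor
  · intro h
    have hpsd := PosSemidef.of_dotProduct_mulVec_nonneg hH fun v ↦ by
      rw [star_trivial, ← Sum.elim_comp_inl_inr v, bellman_block_quadratic_form]
      exact sub_nonneg.2 (h _ _)
    exact ⟨posDef_of_bellman_block_posSemidef hA hR hpsd, hpsd⟩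
  · rintro ⟨-, h⟩ x u
    have hxu := h.dotProduct_mulVec_nonneg (Sum.elim u x)
    rw [star_trivial, bellman_block_quadratic_form] at hxu
    exact sub_nonneg.1 hxu
end

section
/- Quadratic structure of the linear-quadratic transport cost: consider the linear system x_{k+1} = A x_k + B u_k on ℝ^n with A ∈ ℝ^{n×n}, B ∈ ℝ^{n×m}, and quadratic Lagrangian L(x,u) = x^T Q x + u^T R u with Q symmetric positive semidefinite and R symmetric positive definite. Assume (A,B) is controllable (the matrix [B, AB, …, A^{n−1}B] has rank n) and the horizon satisfies T − 1 ≥ n. Define c_1^T(x,y) := inf over control sequences (u_1,…,u_{T−1}) ∈ (ℝ^m)^{T−1} steering x_1 = x to x_T = y of ∑_{k=1}^{T−1} L(x_k, u_k). Then c_1^T(x,y) is finite for every (x,y) ∈ ℝ^n × ℝ^n, the infimum is attained, and there exists a symmetric positive semidefinite matrix M ∈ ℝ^{2n×2n} such that c_1^T(x,y) = [x; y]^T M [x; y] for all x, y ∈ ℝ^n. -/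
open Matrix Finset

noncomputable section

/-- Trajectory of the linear system `x_{k+1} = A x_k + B u_k` started at `x`. -/
def ltraj {n m : ℕ} (A : Matrix (Fin n) (Fin n) ℝ) (B : Matrix (Fin n) (Fin m) ℝ)
    (x : Fin n → ℝ) (u : ℕ → Fin m → ℝ) : ℕ → Fin n → ℝ
  | 0 => x
  | k + 1 => A.mulVec (ltraj A B x u k) + B.mulVec (u k)

/-- Minimisation of a positive semidefinite symmetric form over the fibres of a surjective linear
map: if the form is definite on the kernel, the minimisers are given by a linear section. -/
theorem exists_linear_section_minimizing {E F : Type*} [AddCommGroup E] [Module ℝ E]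
    [FiniteDimensional ℝ E] [AddCommGroup F] [Module ℝ F] (b : LinearMap.BilinForm ℝ E)
    (hsymm : ∀ v w, b v w = b w v) (hnonneg : ∀ v, 0 ≤ b v v) (Φ : E →ₗ[ℝ] F)
    (hΦ : Function.Surjective Φ) (hker : ∀ v, Φ v = 0 → b v v = 0 → v = 0) :
    ∃ s : F →ₗ[ℝ] E, (∀ z, Φ (s z) = z) ∧ ∀ w, b (s (Φ w)) (s (Φ w)) ≤ b w w := by
  have hnd : (b.restrict (LinearMap.ker Φ)).Nondegenerate :=
    ⟨fun v hv ↦ Subtype.ext (hker v v.2 (hv v)), fun v hv ↦ Subtype.ext (hker v v.2 (hv v))⟩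
  have hc : IsCompl (LinearMap.ker Φ) (b.orthogonal (LinearMap.ker Φ)) :=
    LinearMap.BilinForm.isCompl_orthogonal_of_restrict_nondegenerate
      (fun v w h ↦ by rw [hsymm, h]) hnd
  obtain ⟨r, hr⟩ := Φ.exists_rightInverse_of_surjective (LinearMap.range_eq_top.2 hΦ)
  have hr' : ∀ z, Φ (r z) = z := fun z ↦ LinearMap.congr_fun hr z
  have hs : ∀ z, Φ (Submodule.projection _ _ hc.symm (r z)) = z := fun z ↦ by
    have h := congrArg Φ (Submodule.projection_add_projection_eq_self hc (r z))
    rw [map_add, LinearMap.mem_ker.1 (Submodule.projection_apply_mem hc (r z)), zero_add] at h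
    rw [h, hr']
  refine ⟨(Submodule.projection _ _ hc.symm).comp r, hs, fun w ↦ ?_⟩
  set p := ((Submodule.projection _ _ hc.symm).comp r) (Φ w) with hp
  have hpo : p ∈ b.orthogonal (LinearMap.ker Φ) := Submodule.projection_apply_mem hc.symm _
  have hk : w - p ∈ LinearMap.ker Φ := by
    rw [LinearMap.mem_ker, map_sub, hp, LinearMap.comp_apply, hs, sub_self]
  have h0 : b (w - p) p = 0 := hpo _ hk
  have h1 : b w w = b (w - p) (w - p) + b (w - p) p + b p (w - p) + b p p := by
    simp only [map_sub, LinearMap.sub_apply]; ring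
  have h2 := hnonneg (w - p)
  rw [hsymm p, h0] at h1
  linarith

section Trajectory

variable {n m : ℕ} (A : Matrix (Fin n) (Fin n) ℝ) (B : Matrix (Fin n) (Fin m) ℝ)

theorem ltraj_congr (x : Fin n → ℝ) {u v : ℕ → Fin m → ℝ} {N : ℕ} (h : ∀ k < N, u k = v k) :
    ∀ k ≤ N, ltraj A B x u k = ltraj A B x v k
  | 0, _ => rfl
  | k + 1, hk => by
    rw [ltraj, ltraj, ltraj_congr x h k (by omega), h k (by omega)]

/-- The trajectory at time `k` as a linear function of the initial state and the controls. -/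
def ltrajLinear (k : ℕ) : ((Fin n → ℝ) × (ℕ → Fin m → ℝ)) →ₗ[ℝ] (Fin n → ℝ) where
  toFun w := ltraj A B w.1 w.2 k
  map_add' v w := by
    induction k with
    | zero => rfl
    | succ k ih =>
      rw [ltraj, ih]
      simp only [ltraj, Prod.snd_add, Pi.add_apply, Matrix.mulVec_add]
      abel
  map_smul' c w := by
    induction k with
    | zero => rfl
    | succ k ih =>
      rw [ltraj, ih]
      simp only [ltraj, Prod.smul_snd, Pi.smul_apply, Matrix.mulVec_smul, RingHom.id_apply,
        smul_add]

theorem ltraj_eq_sum (x : Fin n → ℝ) (u : ℕ → Fin m → ℝ) (k : ℕ) :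
    ltraj A B x u k =
      (A ^ k).mulVec x + ∑ j ∈ Finset.range k, (A ^ j * B).mulVec (u (k - 1 - j)) := by
  induction k with
  | zero => simp [ltraj]
  | succ k ih =>
    rw [ltraj, ih, Finset.sum_range_succ', Matrix.mulVec_add, Matrix.mulVec_mulVec, ← pow_succ',
      Matrix.mulVec_sum, add_assoc]
    congr 2
    · refine Finset.sum_congr rfl fun j _ ↦ ?_
      rw [Matrix.mulVec_mulVec, ← Matrix.mul_assoc, ← pow_succ',
        show k + 1 - 1 - (j + 1) = k - 1 - j by omega]
    · simp

/-- A controllable system can be steered between any two states in at least `n` steps. -/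
theorem exists_ltraj_eq
    (hctrb : (Matrix.of fun (i : Fin n) (j : Fin n × Fin m) =>
      (A ^ (j.1 : ℕ) * B) i j.2).rank = n)
    {N : ℕ} (hN : n ≤ N) (x y : Fin n → ℝ) : ∃ u : ℕ → Fin m → ℝ, ltraj A B x u N = y := by
  set C := Matrix.of fun (i : Fin n) (j : Fin n × Fin m) => (A ^ (j.1 : ℕ) * B) i j.2 with hC
  have hsurj : LinearMap.range C.mulVecLin = ⊤ := by
    apply Submodule.eq_top_of_finrank_eq
    rw [Module.finrank_fin_fun]
    exact hctrb
  obtain ⟨v, hv⟩ := LinearMap.range_eq_top.1 hsurj (y - (A ^ N).mulVec x)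
  let f : ℕ → Fin m → ℝ := fun j ↦ if h : j < n then fun l ↦ v (⟨j, h⟩, l) else 0
  refine ⟨fun k ↦ f (N - 1 - k), ?_⟩
  have hsum : ∑ j ∈ Finset.range N, (A ^ j * B).mulVec (f (N - 1 - (N - 1 - j))) =
      C.mulVec v := by
    calc _ = ∑ j ∈ Finset.range N, (A ^ j * B).mulVec (f j) :=
          Finset.sum_congr rfl fun j hj ↦ by
            rw [Finset.mem_range] at hj
            rw [show N - 1 - (N - 1 - j) = j by omega]
      _ = ∑ j ∈ Finset.range n, (A ^ j * B).mulVec (f j) := by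
          refine (Finset.sum_subset (Finset.range_mono hN) fun j _ hj ↦ ?_).symm
          rw [Finset.mem_range] at hj
          simp [f, hj]
      _ = ∑ j : Fin n, (A ^ (j : ℕ) * B).mulVec fun l ↦ v (j, l) := by
          rw [Finset.sum_range]
          simp [f]
      _ = C.mulVec v := by
          ext i
          simp only [Finset.sum_apply, Matrix.mulVec, dotProduct, Fintype.sum_prod_type, hC,
            Matrix.of_apply]
  rw [Matrix.mulVecLin_apply] at hv
  rw [ltraj_eq_sum, hsum, hv, add_sub_cancel]

/-- Extension of a finite control sequence by zero. -/
def extendControl (m N : ℕ) : (Fin N → Fin m → ℝ) →ₗ[ℝ] (ℕ → Fin m → ℝ) :=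
  LinearMap.pi fun k ↦ if h : k < N then LinearMap.proj ⟨k, h⟩ else 0

theorem extendControl_apply {N : ℕ} (u : ℕ → Fin m → ℝ) {k : ℕ} (hk : k < N) :
    extendControl m N (fun i ↦ u i) k = u k := by
  simp [extendControl, hk]

/-- The state at time `k`, as a function of the initial state and the first `N` controls. -/
def stateLinear (N k : ℕ) : ((Fin n → ℝ) × (Fin N → Fin m → ℝ)) →ₗ[ℝ] (Fin n → ℝ) :=
  ltrajLinear A B k ∘ₗ LinearMap.prodMap LinearMap.id (extendControl m N)

theorem stateLinear_apply (N k : ℕ) (w : (Fin n → ℝ) × (Fin N → Fin m → ℝ)) :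
    stateLinear A B N k w = ltraj A B w.1 (extendControl m N w.2) k := rfl

/-- The linear-quadratic cost over `N` steps as a bilinear form. -/
def costForm (Q : Matrix (Fin n) (Fin n) ℝ) (R : Matrix (Fin m) (Fin m) ℝ) (N : ℕ) :
    LinearMap.BilinForm ℝ ((Fin n → ℝ) × (Fin N → Fin m → ℝ)) :=
  ∑ k ∈ Finset.range N,
    ((Matrix.toBilin' Q).comp (stateLinear A B N k) (stateLinear A B N k) +
      (Matrix.toBilin' R).comp
        (LinearMap.proj k ∘ₗ extendControl m N ∘ₗ LinearMap.snd ℝ _ _)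
        (LinearMap.proj k ∘ₗ extendControl m N ∘ₗ LinearMap.snd ℝ _ _))

theorem costForm_apply (Q : Matrix (Fin n) (Fin n) ℝ) (R : Matrix (Fin m) (Fin m) ℝ) (N : ℕ)
    (v w : (Fin n → ℝ) × (Fin N → Fin m → ℝ)) :
    costForm A B Q R N v w = ∑ k ∈ Finset.range N,
      (ltraj A B v.1 (extendControl m N v.2) k ⬝ᵥ
          Q.mulVec (ltraj A B w.1 (extendControl m N w.2) k) +
        extendControl m N v.2 k ⬝ᵥ R.mulVec (extendControl m N w.2 k)) := by
  simp [costForm, LinearMap.sum_apply, Matrix.toBilin'_apply', stateLinear_apply]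

/-- The pair of initial and final states of a trajectory. -/
def endpoints (N : ℕ) : ((Fin n → ℝ) × (Fin N → Fin m → ℝ)) →ₗ[ℝ] (Fin n ⊕ Fin n → ℝ) :=
  (LinearEquiv.sumArrowLequivProdArrow (Fin n) (Fin n) ℝ ℝ).symm.toLinearMap ∘ₗ
    (LinearMap.fst ℝ _ _).prod (stateLinear A B N N)

theorem endpoints_apply (N : ℕ) (w : (Fin n → ℝ) × (Fin N → Fin m → ℝ)) :
    endpoints A B N w = Sum.elim w.1 (ltraj A B w.1 (extendControl m N w.2) N) := rfl

end Trajectory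

theorem dotProduct_mulVec_comm_of_isHermitian {ι : Type*} [Fintype ι] {M : Matrix ι ι ℝ}
    (hM : M.IsHermitian) (v w : ι → ℝ) : v ⬝ᵥ M.mulVec w = w ⬝ᵥ M.mulVec v := by
  rw [Matrix.dotProduct_mulVec, dotProduct_comm, ← Matrix.mulVec_transpose,
    ← Matrix.conjTranspose_eq_transpose_of_trivial, hM.eq]

/-- for the controllable linear system `x_{k+1} = A x_k + B u_k` with
quadratic Lagrangian `L(x,u) = xᵀ Q x + uᵀ R u` (`Q` PSD, `R` PD) and horizon `T - 1 ≥ n`,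
the optimal steering cost `c_1^T(x,y)` is finite, attained, and is a PSD quadratic form of
the concatenated vector `[x; y]`: there is a PSD matrix `M` with
`c_1^T(x,y) = [x; y]ᵀ M [x; y]` for all `x, y`.  (`IsLeast S v` says `v ∈ S` and `v` is a
lower bound of `S`, i.e. the infimum is finite and attained with value `v`.) -/
theorem lq_cost_is_quadratic
    (n m T : ℕ) (hT : 2 ≤ T) (hTn : n ≤ T - 1)
    (A : Matrix (Fin n) (Fin n) ℝ) (B : Matrix (Fin n) (Fin m) ℝ)
    (Q : Matrix (Fin n) (Fin n) ℝ) (hQ : Q.PosSemidef)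
    (R : Matrix (Fin m) (Fin m) ℝ) (hR : R.PosDef)
    (hctrb : (Matrix.of fun (i : Fin n) (j : Fin n × Fin m) =>
      (A ^ (j.1 : ℕ) * B) i j.2).rank = n) :
    ∃ M : Matrix (Fin n ⊕ Fin n) (Fin n ⊕ Fin n) ℝ, M.PosSemidef ∧
      ∀ x y : Fin n → ℝ,
        IsLeast {r : ℝ | ∃ u : ℕ → Fin m → ℝ, ltraj A B x u (T - 1) = y ∧
            r = ∑ k ∈ Finset.range (T - 1),
              (ltraj A B x u k ⬝ᵥ Q.mulVec (ltraj A B x u k) + u k ⬝ᵥ R.mulVec (u k))}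
          (Sum.elim x y ⬝ᵥ M.mulVec (Sum.elim x y)) := by
  generalize hN : T - 1 = N at *
  have hQ0 : ∀ v, 0 ≤ v ⬝ᵥ Q.mulVec v := hQ.dotProduct_mulVec_nonneg
  have hR0 : ∀ v, 0 ≤ v ⬝ᵥ R.mulVec v := hR.posSemidef.dotProduct_mulVec_nonneg
  have hext : ∀ (x : Fin n → ℝ) (u : ℕ → Fin m → ℝ) (k : ℕ), k ≤ N →
      ltraj A B x (extendControl m N fun i ↦ u i) k = ltraj A B x u k := fun x u k hk ↦
    ltraj_congr A B x (fun _ hj ↦ extendControl_apply u hj) k hk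
  have hnonneg : ∀ w, 0 ≤ costForm A B Q R N w w := fun w ↦ by
    rw [costForm_apply]
    exact Finset.sum_nonneg fun k _ ↦ add_nonneg (hQ0 _) (hR0 _)
  have hsymm : ∀ v w, costForm A B Q R N v w = costForm A B Q R N w v := fun v w ↦ by
    rw [costForm_apply, costForm_apply]
    refine Finset.sum_congr rfl fun k _ ↦ ?_
    rw [dotProduct_mulVec_comm_of_isHermitian hQ.1, dotProduct_mulVec_comm_of_isHermitian hR.1]
  have hsurj : Function.Surjective (endpoints (m := m) A B N) := fun z ↦ by
    obtain ⟨u, hu⟩ := exists_ltraj_eq A B hctrb hTn (z ∘ Sum.inl) (z ∘ Sum.inr)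
    refine ⟨(z ∘ Sum.inl, fun i ↦ u i), ?_⟩
    rw [endpoints_apply, hext _ _ _ le_rfl, hu, Sum.elim_comp_inl_inr]
  have hker : ∀ w, endpoints A B N w = 0 → costForm A B Q R N w w = 0 → w = 0 := by
    rintro ⟨x, u⟩ h0 hc
    refine Prod.ext (funext fun i ↦ congrFun h0 (Sum.inl i)) (funext fun k ↦ ?_)
    rw [costForm_apply, Finset.sum_eq_zero_iff_of_nonneg
      fun k _ ↦ add_nonneg (hQ0 _) (hR0 _)] at hc
    have hk := hc k (Finset.mem_range.2 k.2)
    have hu : extendControl m N u k = u k := by simp [extendControl]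
    by_contra hne
    have hpos : 0 < u k ⬝ᵥ R.mulVec (u k) := hR.dotProduct_mulVec_pos hne
    rw [hu] at hk
    exact (add_pos_of_nonneg_of_pos (hQ0 _) hpos).ne' hk
  obtain ⟨s, hs, hmin⟩ := exists_linear_section_minimizing _ hsymm hnonneg _ hsurj hker
  have hM : ∀ v w, v ⬝ᵥ (LinearMap.BilinForm.toMatrix' ((costForm A B Q R N).comp s s)).mulVec w =
      costForm A B Q R N (s v) (s w) := fun v w ↦ by
    rw [← Matrix.toBilin'_apply', Matrix.toBilin'_toMatrix', LinearMap.BilinForm.comp_apply]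
  refine ⟨LinearMap.BilinForm.toMatrix' ((costForm A B Q R N).comp s s),
    .of_dotProduct_mulVec_nonneg ?_ fun z ↦ ?_, fun x y ↦ ⟨?_, ?_⟩⟩
  · ext i j
    simp only [Matrix.conjTranspose_apply, LinearMap.BilinForm.toMatrix'_apply, star_trivial,
      LinearMap.BilinForm.comp_apply]
    exact hsymm _ _
  · rw [star_trivial, hM]
    exact hnonneg _
  · have h := hs (Sum.elim x y)
    rw [endpoints_apply] at h
    have h1 : (s (Sum.elim x y)).1 = x := funext fun i ↦ congrFun h (Sum.inl i)
    refine ⟨extendControl m N (s (Sum.elim x y)).2, funext fun i ↦ ?_, ?_⟩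
    · simpa only [h1, Sum.elim_inr] using congrFun h (Sum.inr i)
    · rw [hM, costForm_apply, h1]
  · rintro _ ⟨u, hu, rfl⟩
    have h := hmin (x, fun i ↦ u i)
    rw [endpoints_apply, hext _ _ _ le_rfl, hu, ← hM, costForm_apply] at h
    refine h.trans_eq (Finset.sum_congr rfl fun k hk ↦ ?_)
    rw [Finset.mem_range] at hk
    rw [hext _ _ _ hk.le, extendControl_apply _ hk]
end
end

section
/- SDP characterization of the squared Wasserstein-2 distance between centered Gaussians: let μ and ν be the zero-mean multivariate Gaussian measures on ℝ^n with positive definite covariances Σ_1 and Σ_2. Then inf { ∫_{ℝ^n×ℝ^n} ‖x − y‖² dπ(x,y) : π a probability measure on ℝ^n×ℝ^n with marginals μ and ν } = sup { Tr(P_1 Σ_1 − P_2 Σ_2) : P_1, P_2 ∈ ℝ^{n×n} symmetric, I + P_2 positive definite, and the block matrix fromBlocks (I + P_2) P_2; P_2 (P_2 − P_1) positive semidefinite }. -/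
open MeasureTheory Matrix Finset
open scoped ENNReal
open ProbabilityTheory

noncomputable section

/-- The standard Gaussian measure on `Fin n → ℝ`. -/
def stdGaussianPi (n : ℕ) : Measure (Fin n → ℝ) :=
  Measure.pi fun _ => gaussianReal 0 1

instance (n : ℕ) : IsProbabilityMeasure (stdGaussianPi n) := by
  unfold stdGaussianPi; infer_instance

lemma prod_gaussianPDFReal_zero_one {n : ℕ} (x : Fin n → ℝ) :
    ∏ i, gaussianPDFReal 0 1 (x i) =
      (Real.sqrt ((2 * Real.pi) ^ n))⁻¹ * Real.exp (-(x ⬝ᵥ x) / 2) := by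
  simp only [gaussianPDFReal, NNReal.coe_one, mul_one, sub_zero, Finset.prod_mul_distrib,
    Finset.prod_const, Finset.card_univ, Fintype.card_fin, ← Real.exp_sum]
  congr 1
  · rw [inv_pow, Real.sqrt_eq_rpow, Real.sqrt_eq_rpow, ← Real.rpow_natCast, ← Real.rpow_natCast,
      ← Real.rpow_mul (by positivity), ← Real.rpow_mul (by positivity),
      mul_comm (1 / 2 : ℝ)]
  · rw [dotProduct, ← Finset.sum_div, ← Finset.sum_neg_distrib]
    simp only [pow_two]

lemma stdGaussianPi_eq_withDensity (n : ℕ) :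
    stdGaussianPi n = volume.withDensity fun x => ENNReal.ofReal
      ((Real.sqrt ((2 * Real.pi) ^ n))⁻¹ * Real.exp (-(x ⬝ᵥ x) / 2)) := by
  refine Measure.pi_eq fun s hs => ?_
  simp only [← prod_gaussianPDFReal_zero_one]
  rw [withDensity_apply _ (MeasurableSet.univ_pi hs), volume_pi, Measure.restrict_pi_pi,
    ← ofReal_integral_eq_lintegral_ofReal, integral_fintype_prod_eq_prod]
  · rw [ENNReal.ofReal_prod_of_nonneg
      fun i _ => integral_nonneg fun x => gaussianPDFReal_nonneg _ _ _]
    simp only [gaussianReal_apply_eq_integral _ one_ne_zero]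
  · exact Integrable.fintype_prod fun i => (integrable_gaussianPDFReal 0 1).restrict
  · exact ae_of_all _ fun x => Finset.prod_nonneg fun i _ => gaussianPDFReal_nonneg _ _ _

lemma withDensity_gaussian_eq_map_stdGaussianPi {n : ℕ} {S A : Matrix (Fin n) (Fin n) ℝ}
    (hA : IsUnit A.det) (hS : A * Aᵀ = S) :
    (volume.withDensity fun x : Fin n → ℝ =>
      ENNReal.ofReal ((Real.sqrt ((2 * Real.pi) ^ n * S.det))⁻¹ *
        Real.exp (-(x ⬝ᵥ S⁻¹.mulVec x) / 2))) = (stdGaussianPi n).map (A *ᵥ ·) := by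
  have hdet : A.det ≠ 0 := hA.ne_zero
  have hmeas : Measurable (A *ᵥ · : (Fin n → ℝ) → Fin n → ℝ) := by fun_prop
  have hvol : (volume : Measure (Fin n → ℝ)) =
      ENNReal.ofReal |A.det| • volume.map (A *ᵥ · : (Fin n → ℝ) → Fin n → ℝ) := by
    have h := Real.map_matrix_volume_pi_eq_smul_volume_pi hdet
    have h' : (⇑(toLin' A) : (Fin n → ℝ) → Fin n → ℝ) = (A *ᵥ ·) := by ext; simp
    rw [h'] at h
    rw [h, smul_smul, ← ENNReal.ofReal_mul (abs_nonneg _), ← abs_mul, mul_inv_cancel₀ hdet]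
    simp
  have hquad (x : Fin n → ℝ) : (A *ᵥ x) ⬝ᵥ S⁻¹ *ᵥ (A *ᵥ x) = x ⬝ᵥ x := by
    have h : Aᵀ * (S⁻¹ * A) = 1 := by
      rw [← hS, Matrix.mul_inv_rev, Matrix.mul_assoc, nonsing_inv_mul _ hA, Matrix.mul_one,
        mul_nonsing_inv _ (by simpa using hA)]
    rw [mulVec_mulVec, dotProduct_comm, ← dotProduct_transpose_mulVec, mulVec_mulVec, h, one_mulVec]
  have hconst : |A.det| * (Real.sqrt ((2 * Real.pi) ^ n * S.det))⁻¹ =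
      (Real.sqrt ((2 * Real.pi) ^ n))⁻¹ := by
    rw [← hS, det_mul, det_transpose, Real.sqrt_mul (by positivity), Real.sqrt_mul_self_eq_abs]
    field_simp
  ext s hs
  rw [Measure.map_apply hmeas hs, stdGaussianPi_eq_withDensity, withDensity_apply _ hs,
    withDensity_apply _ (hmeas hs)]
  conv_lhs => rw [hvol]
  rw [Measure.restrict_smul, lintegral_smul_measure, setLIntegral_map hs (by fun_prop) hmeas,
    smul_eq_mul, ← lintegral_const_mul _ (by fun_prop)]
  simp only [← ENNReal.ofReal_mul (abs_nonneg _), ← mul_assoc, hconst, hquad]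

lemma memLp_eval_stdGaussianPi {n : ℕ} (i : Fin n) :
    MemLp (fun z => z i) 2 (stdGaussianPi n) :=
  (memLp_id_gaussianReal 2).comp_measurePreserving (measurePreserving_eval _ i)

lemma integral_eval_mul_eval_stdGaussianPi {n : ℕ} (i j : Fin n) :
    ∫ z, z i * z j ∂(stdGaussianPi n) = (1 : Matrix (Fin n) (Fin n) ℝ) i j := by
  rcases eq_or_ne i j with rfl | hij
  · have h := integral_comp_eval (μ := fun _ : Fin n => gaussianReal 0 1) (i := i)
      (f := fun t : ℝ => t * t) (by fun_prop)
    rw [stdGaussianPi, h, one_apply_eq]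
    have hv := variance_eq_sub (memLp_id_gaussianReal (μ := 0) (v := 1) 2)
    simp only [variance_id_gaussianReal, NNReal.coe_one] at hv
    simpa [pow_two] using hv.symm
  · have hind : iIndepFun (fun i (z : Fin n → ℝ) => z i) (stdGaussianPi n) :=
      iIndepFun_pi (X := fun _ => id) fun _ => aemeasurable_id
    rw [(hind.indepFun hij).integral_fun_mul_eq_mul_integral
      (memLp_eval_stdGaussianPi i).1 (memLp_eval_stdGaussianPi j).1,
      one_apply_ne hij, stdGaussianPi, integral_eval]
    simp

lemma integrable_quadForm_stdGaussianPi {n : ℕ} (N : Matrix (Fin n) (Fin n) ℝ) :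
    Integrable (fun z => z ⬝ᵥ N *ᵥ z) (stdGaussianPi n) := by
  simp only [dotProduct, mulVec, Finset.mul_sum]
  refine integrable_finsetSum _ fun i _ => integrable_finsetSum _ fun j _ => ?_
  simpa [mul_left_comm] using
    ((memLp_eval_stdGaussianPi i).integrable_mul (memLp_eval_stdGaussianPi j)).const_mul (N i j)

lemma integral_quadForm_stdGaussianPi {n : ℕ} (N : Matrix (Fin n) (Fin n) ℝ) :
    ∫ z, z ⬝ᵥ N *ᵥ z ∂(stdGaussianPi n) = N.trace := by
  have hint (i j : Fin n) : Integrable (fun z => N i j * (z i * z j)) (stdGaussianPi n) :=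
    ((memLp_eval_stdGaussianPi i).integrable_mul (memLp_eval_stdGaussianPi j)).const_mul (N i j)
  simp only [dotProduct, mulVec, Finset.mul_sum, mul_left_comm (_ : ℝ) (N _ _)]
  rw [integral_finsetSum _ fun i _ => integrable_finsetSum _ fun j _ => hint i j]
  simp only [integral_finsetSum _ fun j _ => hint _ j, integral_const_mul,
    integral_eval_mul_eval_stdGaussianPi, one_apply, mul_ite, mul_one, mul_zero,
    Finset.sum_ite_eq, Finset.mem_univ, if_true, trace, diag_apply]

lemma mulVec_dotProduct_mulVec_mulVec {n : ℕ} (A P : Matrix (Fin n) (Fin n) ℝ) (x : Fin n → ℝ) :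
    (A *ᵥ x) ⬝ᵥ P *ᵥ (A *ᵥ x) = x ⬝ᵥ (Aᵀ * P * A) *ᵥ x := by
  rw [dotProduct_comm, ← dotProduct_transpose_mulVec, mulVec_mulVec, mulVec_mulVec,
    Matrix.mul_assoc]

lemma integrable_quadForm_map_stdGaussianPi {n : ℕ} (A P : Matrix (Fin n) (Fin n) ℝ) :
    Integrable (fun x => x ⬝ᵥ P *ᵥ x) ((stdGaussianPi n).map (A *ᵥ ·)) := by
  rw [integrable_map_measure (by fun_prop) (by fun_prop)]
  simpa only [Function.comp_def, mulVec_dotProduct_mulVec_mulVec]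
    using integrable_quadForm_stdGaussianPi _

lemma integral_quadForm_map_stdGaussianPi {n : ℕ} (A P : Matrix (Fin n) (Fin n) ℝ) :
    ∫ x, x ⬝ᵥ P *ᵥ x ∂((stdGaussianPi n).map (A *ᵥ ·)) = (P * (A * Aᵀ)).trace := by
  rw [integral_map (by fun_prop) (by fun_prop)]
  simp only [mulVec_dotProduct_mulVec_mulVec, integral_quadForm_stdGaussianPi]
  rw [Matrix.mul_assoc, trace_mul_comm, Matrix.mul_assoc]

lemma Matrix.PosDef.exists_posDef_mul_self {n : ℕ} {S : Matrix (Fin n) (Fin n) ℝ}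
    (hS : S.PosDef) : ∃ R : Matrix (Fin n) (Fin n) ℝ, R.PosDef ∧ R * R = S := by
  open scoped MatrixOrder Matrix.Norms.L2Operator in
  exact ⟨CFC.sqrt S, hS.isStrictlyPositive.sqrt.posDef,
    CFC.sqrt_mul_sqrt_self S hS.posSemidef.nonneg⟩

lemma Matrix.PosDef.transpose_eq {n : ℕ} {S : Matrix (Fin n) (Fin n) ℝ} (hS : S.PosDef) :
    Sᵀ = S := by
  simpa using hS.isHermitian.eq

/-- The linear optimal transport map between two centered Gaussians. -/
lemma Matrix.PosDef.exists_posDef_mul_mul_self {n : ℕ} {S₁ S₂ : Matrix (Fin n) (Fin n) ℝ}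
    (hS₁ : S₁.PosDef) (hS₂ : S₂.PosDef) :
    ∃ T : Matrix (Fin n) (Fin n) ℝ, T.PosDef ∧ T * S₁ * T = S₂ := by
  obtain ⟨R, hR, hRR⟩ := hS₁.exists_posDef_mul_self
  have hconj {B M : Matrix (Fin n) (Fin n) ℝ} (hB : B.PosDef) (hM : M.PosDef) :
      (B * M * B).PosDef := by
    simpa [hB.transpose_eq] using
      hM.mul_mul_conjTranspose_same (B := B) (vecMul_injective_iff_isUnit.mpr hB.isUnit)
  obtain ⟨Q, hQ, hQQ⟩ := (hconj hR hS₂).exists_posDef_mul_self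
  have hu : IsUnit R.det := (isUnit_iff_isUnit_det R).mp hR.isUnit
  have h₁ : R⁻¹ * R = 1 := nonsing_inv_mul R hu
  have h₂ : R * R⁻¹ = 1 := mul_nonsing_inv R hu
  refine ⟨R⁻¹ * Q * R⁻¹, hconj hR.inv hQ, ?_⟩
  calc R⁻¹ * Q * R⁻¹ * S₁ * (R⁻¹ * Q * R⁻¹)
      = R⁻¹ * Q * (R⁻¹ * R) * (R * R⁻¹) * Q * R⁻¹ := by rw [← hRR]; noncomm_ring
    _ = R⁻¹ * (Q * Q) * R⁻¹ := by rw [h₁, h₂]; noncomm_ring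
    _ = (R⁻¹ * R) * S₂ * (R * R⁻¹) := by rw [hQQ]; noncomm_ring
    _ = S₂ := by rw [h₁, h₂]; simp

lemma quadForm_sub_le_of_posSemidef {n : ℕ} {P₁ P₂ : Matrix (Fin n) (Fin n) ℝ}
    (h : (fromBlocks (1 + P₂) P₂ P₂ (P₂ - P₁)).PosSemidef) (x y : Fin n → ℝ) :
    x ⬝ᵥ P₁ *ᵥ x - y ⬝ᵥ P₂ *ᵥ y ≤ ∑ i, (x i - y i) ^ 2 := by
  have hsq : ∑ i, (x i - y i) ^ 2 = (y - x) ⬝ᵥ (y - x) := by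
    simp only [dotProduct, Pi.sub_apply]
    exact Finset.sum_congr rfl fun i _ => by ring
  have h0 := h.dotProduct_mulVec_nonneg (Sum.elim (y - x) x)
  simp only [star_trivial, fromBlocks_mulVec, sumElim_dotProduct_sumElim, add_mulVec,
    sub_mulVec, mulVec_sub, one_mulVec, dotProduct_add, dotProduct_sub, sub_dotProduct,
    Function.comp_def, Sum.elim_inl, Sum.elim_inr] at h0
  simp only [hsq, dotProduct_sub, sub_dotProduct]
  linarith

lemma trace_sub_le_integral_of_map_eq {n : ℕ} {P₁ P₂ A B : Matrix (Fin n) (Fin n) ℝ}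
    (h : (fromBlocks (1 + P₂) P₂ P₂ (P₂ - P₁)).PosSemidef)
    {π : Measure ((Fin n → ℝ) × (Fin n → ℝ))}
    (hfst : π.map Prod.fst = (stdGaussianPi n).map (A *ᵥ ·))
    (hsnd : π.map Prod.snd = (stdGaussianPi n).map (B *ᵥ ·)) :
    (P₁ * (A * Aᵀ) - P₂ * (B * Bᵀ)).trace ≤ ∫ p, ∑ i, (p.1 i - p.2 i) ^ 2 ∂π := by
  have hint₁ (P : Matrix (Fin n) (Fin n) ℝ) : Integrable (fun p => p.1 ⬝ᵥ P *ᵥ p.1) π := by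
    have := integrable_quadForm_map_stdGaussianPi A P
    rw [← hfst] at this
    exact this.comp_measurable measurable_fst
  have hint₂ (P : Matrix (Fin n) (Fin n) ℝ) : Integrable (fun p => p.2 ⬝ᵥ P *ᵥ p.2) π := by
    have := integrable_quadForm_map_stdGaussianPi B P
    rw [← hsnd] at this
    exact this.comp_measurable measurable_snd
  have hcost : Integrable (fun p => ∑ i, (p.1 i - p.2 i) ^ 2) π := by
    refine (((hint₁ 1).add (hint₂ 1)).const_mul 2).mono' (by fun_prop) (ae_of_all _ fun p => ?_)
    rw [Real.norm_of_nonneg (Finset.sum_nonneg fun i _ => sq_nonneg _)]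
    simp only [Pi.add_apply, one_mulVec, dotProduct, ← Finset.sum_add_distrib, Finset.mul_sum]
    exact Finset.sum_le_sum fun i _ => by nlinarith [sq_nonneg (p.1 i + p.2 i)]
  rw [trace_sub, ← integral_quadForm_map_stdGaussianPi A, ← integral_quadForm_map_stdGaussianPi B,
    ← hfst, ← hsnd, integral_map (by fun_prop) (by fun_prop),
    integral_map (by fun_prop) (by fun_prop), ← integral_sub (hint₁ P₁) (hint₂ P₂)]
  exact integral_mono ((hint₁ P₁).sub (hint₂ P₂)) hcost
    fun p => quadForm_sub_le_of_posSemidef h p.1 p.2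

lemma integral_sq_sub_map_stdGaussianPi {n : ℕ} (A B : Matrix (Fin n) (Fin n) ℝ) :
    ∫ p, ∑ i, (p.1 i - p.2 i) ^ 2 ∂((stdGaussianPi n).map fun z => (A *ᵥ z, B *ᵥ z)) =
      ((A - B)ᵀ * (A - B)).trace := by
  rw [integral_map (by fun_prop) (by fun_prop), ← integral_quadForm_stdGaussianPi]
  refine integral_congr_ae (ae_of_all _ fun z => ?_)
  have h := mulVec_dotProduct_mulVec_mulVec (A - B) 1 z
  rw [one_mulVec, Matrix.mul_one] at h
  beta_reduce
  rw [← h]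
  simp only [sub_mulVec, dotProduct, Pi.sub_apply, pow_two]

lemma Matrix.PosDef.posSemidef_fromBlocks_inv {n : ℕ} {T : Matrix (Fin n) (Fin n) ℝ}
    (hT : T.PosDef) :
    (fromBlocks (1 + (T⁻¹ - 1)) (T⁻¹ - 1) (T⁻¹ - 1) (T⁻¹ - 1 - (1 - T))).PosSemidef := by
  have hu : IsUnit T.det := (isUnit_iff_isUnit_det T).mp hT.isUnit
  have h₁ : T⁻¹ * T = 1 := nonsing_inv_mul T hu
  have h₂ : T * T⁻¹ = 1 := mul_nonsing_inv T hu
  have h := hT.inv.posSemidef.conjTranspose_mul_mul_same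
    (fromCols (1 : Matrix (Fin n) (Fin n) ℝ) (1 - T))
  rw [conjTranspose_eq_transpose_of_trivial, transpose_fromCols, fromRows_mul,
    fromRows_mul_fromCols] at h
  simp only [transpose_one, transpose_sub, hT.transpose_eq, Matrix.one_mul, Matrix.mul_one,
    Matrix.mul_sub, Matrix.sub_mul, h₁, h₂] at h
  rwa [add_sub_cancel]

/-- SDP characterization of the squared Wasserstein-2 distance between
centered Gaussians: for zero-mean Gaussians `μ`, `ν` on `ℝ^n` with positive definite
covariances `S₁`, `S₂`,
`inf_π ∫ ‖x - y‖² dπ = sup { Tr(P₁ S₁ - P₂ S₂) }` over symmetric `P₁, P₂` with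
`I + P₂ ≻ 0` and `fromBlocks (I + P₂) P₂ P₂ (P₂ - P₁) ⪰ 0`. -/
theorem wasserstein_gaussian_sdp
    (n : ℕ)
    (S₁ S₂ : Matrix (Fin n) (Fin n) ℝ) (hS₁ : S₁.PosDef) (hS₂ : S₂.PosDef)
    (μ ν : Measure (Fin n → ℝ))
    (hμ : μ = volume.withDensity fun x =>
      ENNReal.ofReal ((Real.sqrt ((2 * Real.pi) ^ n * S₁.det))⁻¹ *
        Real.exp (-(x ⬝ᵥ S₁⁻¹.mulVec x) / 2)))
    (hν : ν = volume.withDensity fun x =>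
      ENNReal.ofReal ((Real.sqrt ((2 * Real.pi) ^ n * S₂.det))⁻¹ *
        Real.exp (-(x ⬝ᵥ S₂⁻¹.mulVec x) / 2))) :
    sInf {r : ℝ | ∃ π : Measure ((Fin n → ℝ) × (Fin n → ℝ)),
        IsProbabilityMeasure π ∧ π.map Prod.fst = μ ∧ π.map Prod.snd = ν ∧
        r = ∫ p, ∑ i, (p.1 i - p.2 i) ^ 2 ∂π} =
      sSup {r : ℝ | ∃ P₁ P₂ : Matrix (Fin n) (Fin n) ℝ, P₁.IsSymm ∧ P₂.IsSymm ∧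
        (1 + P₂).PosDef ∧
        (Matrix.fromBlocks (1 + P₂) P₂ P₂ (P₂ - P₁)).PosSemidef ∧
        r = (P₁ * S₁ - P₂ * S₂).trace} := by
  obtain ⟨A, hA, hAS⟩ := hS₁.exists_posDef_mul_self
  obtain ⟨T, hT, hTS⟩ := hS₁.exists_posDef_mul_mul_self hS₂
  have huA : IsUnit A.det := (isUnit_iff_isUnit_det A).mp hA.isUnit
  have huT : IsUnit T.det := (isUnit_iff_isUnit_det T).mp hT.isUnit
  have hAt : A * Aᵀ = S₁ := by rw [hA.transpose_eq, hAS]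
  have hBt : (T * A) * (T * A)ᵀ = S₂ := by
    rw [transpose_mul, hT.transpose_eq, hA.transpose_eq, ← hTS, ← hAS]
    noncomm_ring
  rw [withDensity_gaussian_eq_map_stdGaussianPi huA hAt] at hμ
  rw [withDensity_gaussian_eq_map_stdGaussianPi (by rw [det_mul]; exact huT.mul huA) hBt] at hν
  have hle {P₁ P₂ : Matrix (Fin n) (Fin n) ℝ}
      (hP : (fromBlocks (1 + P₂) P₂ P₂ (P₂ - P₁)).PosSemidef)
      {π : Measure ((Fin n → ℝ) × (Fin n → ℝ))} (h₁ : π.map Prod.fst = μ)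
      (h₂ : π.map Prod.snd = ν) :
      (P₁ * S₁ - P₂ * S₂).trace ≤ ∫ p, ∑ i, (p.1 i - p.2 i) ^ 2 ∂π := by
    rw [← hAt, ← hBt]
    exact trace_sub_le_integral_of_map_eq hP (h₁.trans hμ) (h₂.trans hν)
  let π₀ := (stdGaussianPi n).map fun z => (A *ᵥ z, (T * A) *ᵥ z)
  have hmeas : Measurable fun z : Fin n → ℝ => (A *ᵥ z, (T * A) *ᵥ z) := by fun_prop
  have hπ₀ : IsProbabilityMeasure π₀ := Measure.isProbabilityMeasure_map hmeas.aemeasurable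
  have hfst : π₀.map Prod.fst = μ := by
    rw [hμ, Measure.map_map measurable_fst hmeas]; rfl
  have hsnd : π₀.map Prod.snd = ν := by
    rw [hν, Measure.map_map measurable_snd hmeas]; rfl
  have hvalue : ∫ p, ∑ i, (p.1 i - p.2 i) ^ 2 ∂π₀ =
      ((1 - T) * S₁ - (T⁻¹ - 1) * S₂).trace := by
    have hprimal : (A - T * A) * (A - T * A)ᵀ = S₁ - S₁ * T - T * S₁ + S₂ := by
      rw [transpose_sub, transpose_mul, hT.transpose_eq, hA.transpose_eq, ← hTS, ← hAS]
      noncomm_ring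
    have hdual : T⁻¹ * S₂ = S₁ * T := by
      rw [← hTS, ← Matrix.mul_assoc, ← Matrix.mul_assoc, nonsing_inv_mul _ huT, Matrix.one_mul]
    rw [integral_sq_sub_map_stdGaussianPi, trace_mul_comm, hprimal, Matrix.sub_mul, Matrix.sub_mul,
      hdual, Matrix.one_mul, Matrix.one_mul]
    congr 1
    abel
  have hsymm {M : Matrix (Fin n) (Fin n) ℝ} (hM : M.PosDef) : M.IsSymm := hM.transpose_eq
  have hleast : IsLeast {r : ℝ | ∃ π : Measure ((Fin n → ℝ) × (Fin n → ℝ)),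
      IsProbabilityMeasure π ∧ π.map Prod.fst = μ ∧ π.map Prod.snd = ν ∧
      r = ∫ p, ∑ i, (p.1 i - p.2 i) ^ 2 ∂π} (∫ p, ∑ i, (p.1 i - p.2 i) ^ 2 ∂π₀) := by
    refine ⟨⟨π₀, hπ₀, hfst, hsnd, rfl⟩, ?_⟩
    rintro r ⟨π, -, h₁, h₂, rfl⟩
    rw [hvalue]
    exact hle hT.posSemidef_fromBlocks_inv h₁ h₂
  have hgreatest : IsGreatest {r : ℝ | ∃ P₁ P₂ : Matrix (Fin n) (Fin n) ℝ, P₁.IsSymm ∧ P₂.IsSymm ∧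
      (1 + P₂).PosDef ∧ (Matrix.fromBlocks (1 + P₂) P₂ P₂ (P₂ - P₁)).PosSemidef ∧
      r = (P₁ * S₁ - P₂ * S₂).trace} (∫ p, ∑ i, (p.1 i - p.2 i) ^ 2 ∂π₀) := by
    refine ⟨⟨1 - T, T⁻¹ - 1, isSymm_one.sub (hsymm hT), (hsymm hT.inv).sub isSymm_one,
      by simpa using hT.inv, hT.posSemidef_fromBlocks_inv, hvalue⟩, ?_⟩
    rintro r ⟨P₁, P₂, -, -, -, hP, rfl⟩
    exact hle hP hfst hsnd
  rw [hleast.csInf_eq, hgreatest.csSup_eq]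
end
end
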